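/- For every n ≥ 1, the number of two-colored non-crossing pair partitions of {1,…,2n} in which every pair has relative depth 1 (i.e. the cardinality of TCNC_2^{2,2}(2n)) equals binomial(2n, n). -/

import Mathlib

/-- `π` is a pair partition of `{1, …, m}`. -/
def IsPairPartition (m : ℕ) (π : Finset (Finset ℕ)) : Prop :=
  (∀ P ∈ π, P.card = 2) ∧
  (∀ i : ℕ, (∃ P ∈ π, i ∈ P) ↔ i ∈ Finset.Icc 1 m) ∧
  (∀ P ∈ π, ∀ Q ∈ π, P ≠ Q → Disjoint P Q)

/-- Non-crossing: there are no two pairs `{a,c}`, `{b,d}` with `a < b < c < d`. -/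
def NonCrossing (π : Finset (Finset ℕ)) : Prop :=
  ∀ P ∈ π, ∀ Q ∈ π, P ≠ Q →
    ¬ ∃ a ∈ P, ∃ b ∈ Q, ∃ c ∈ P, ∃ d ∈ Q, a < b ∧ b < c ∧ c < d

/-- `P` is nested inside `Q = {c, d}` (`c < d`) if `c < min P` and `max P < d`. -/
def Nested (P Q : Finset ℕ) : Prop :=
  ∃ c ∈ Q, ∃ d ∈ Q, ∀ x ∈ P, c < x ∧ x < d

/-- The relative depth of a pair `P` of a given color (`S` = pairs of the same
color as `P`, `O` = pairs of the opposite color): the number of pairs `Q ∈ S`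
with (`Q = P` or `P` nested inside `Q`) such that `Q` is nested inside every
pair of the opposite color in which `P` is nested. -/
noncomputable def relDepth (S O : Finset (Finset ℕ)) (P : Finset ℕ) : ℕ :=
  Set.ncard {Q : Finset ℕ | Q ∈ S ∧ (Q = P ∨ Nested P Q) ∧
    ∀ R ∈ O, Nested P R → Nested Q R}

/-- A two-colored non-crossing pair partition of `{1, …, 2n}`, given as the pair
`c = (blue pairs, red pairs)`, belonging to `TCNC_2^{k,ℓ}(2n)`: every blue pair
has relative depth at most `k − 1` and every red pair has relative depth at
most `ℓ − 1`. -/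
def MemTCNC2 (k l n : ℕ) (c : Finset (Finset ℕ) × Finset (Finset ℕ)) : Prop :=
  Disjoint c.1 c.2 ∧ IsPairPartition (2 * n) (c.1 ∪ c.2) ∧ NonCrossing (c.1 ∪ c.2) ∧
  (∀ P ∈ c.1, relDepth c.1 c.2 P ≤ k - 1) ∧
  (∀ P ∈ c.2, relDepth c.2 c.1 P ≤ l - 1)

/-- The pair `{a, b}` with `a < b` belongs to `π`. -/
def IsArc (π : Finset (Finset ℕ)) (a b : ℕ) : Prop :=
  a < b ∧ {a, b} ∈ π

theorem nested_pair_iff {a b c d : ℕ} (hab : a < b) (hcd : c < d) :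
    Nested {a, b} {c, d} ↔ c < a ∧ b < d := by
  simp only [Nested, Finset.mem_insert, Finset.mem_singleton]
  constructor
  · rintro ⟨x, hx, y, hy, h⟩
    have h1 := h a (Or.inl rfl)
    have h2 := h b (Or.inr rfl)
    omega
  · rintro ⟨h1, h2⟩
    refine ⟨c, Or.inl rfl, d, Or.inr rfl, ?_⟩
    rintro x (rfl | rfl) <;> omega

theorem relDepth_le_one_iff {S O : Finset (Finset ℕ)} {P : Finset ℕ} (hP : P ∈ S) :
    relDepth S O P ≤ 1 ↔
      ∀ Q ∈ S, Nested P Q → (∀ R ∈ O, Nested P R → Nested Q R) → Q = P := by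
  have hfin : {Q : Finset ℕ | Q ∈ S ∧ (Q = P ∨ Nested P Q) ∧
      ∀ R ∈ O, Nested P R → Nested Q R}.Finite :=
    S.finite_toSet.subset fun Q hQ => hQ.1
  rw [relDepth, Set.ncard_le_one hfin]
  constructor
  · intro h Q hQ hPQ hR
    exact h Q ⟨hQ, Or.inr hPQ, hR⟩ P ⟨hP, Or.inl rfl, fun _ _ h => h⟩
  · rintro h Q ⟨hQ, hPQ, hR⟩ Q' ⟨hQ', hPQ', hR'⟩
    have h1 : Q = P := hPQ.elim id fun h' => h Q hQ h' hR
    have h2 : Q' = P := hPQ'.elim id fun h' => h Q' hQ' h' hR'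
    rw [h1, h2]

section Arcs

variable {m : ℕ} {π : Finset (Finset ℕ)}

theorem IsPairPartition.exists_isArc (h : IsPairPartition m π) {P : Finset ℕ} (hP : P ∈ π) :
    ∃ a b, IsArc π a b ∧ P = {a, b} := by
  obtain ⟨x, y, hxy, rfl⟩ := Finset.card_eq_two.1 (h.1 P hP)
  rcases lt_or_gt_of_ne hxy with hlt | hlt
  · exact ⟨x, y, ⟨hlt, hP⟩, rfl⟩
  · exact ⟨y, x, ⟨hlt, by rwa [Finset.pair_comm]⟩, Finset.pair_comm x y⟩

theorem IsPairPartition.eq_of_mem (h : IsPairPartition m π) {P Q : Finset ℕ} {i : ℕ}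
    (hP : P ∈ π) (hQ : Q ∈ π) (hiP : i ∈ P) (hiQ : i ∈ Q) : P = Q := by
  by_contra hne
  exact Finset.disjoint_left.1 (h.2.2 P hP Q hQ hne) hiP hiQ

theorem IsPairPartition.exists_partner (h : IsPairPartition m π) {i : ℕ}
    (hi : i ∈ Finset.Icc 1 m) :
    (∃ j, IsArc π i j) ∨ ∃ j, IsArc π j i := by
  obtain ⟨P, hP, hiP⟩ := (h.2.1 i).2 hi
  obtain ⟨a, b, hab, rfl⟩ := h.exists_isArc hP
  simp only [Finset.mem_insert, Finset.mem_singleton] at hiP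
  rcases hiP with rfl | rfl
  · exact Or.inl ⟨b, hab⟩
  · exact Or.inr ⟨a, hab⟩

theorem IsPairPartition.isArc_mem (h : IsPairPartition m π) {a b : ℕ} (hab : IsArc π a b) :
    a ∈ Finset.Icc 1 m ∧ b ∈ Finset.Icc 1 m :=
  ⟨(h.2.1 a).1 ⟨_, hab.2, by simp⟩, (h.2.1 b).1 ⟨_, hab.2, by simp⟩⟩

theorem IsPairPartition.arc_endpoints (h : IsPairPartition m π) {a b c d : ℕ}
    (hab : IsArc π a b) (hcd : IsArc π c d) :
    (a = c ∧ b = d) ∨ (a ≠ c ∧ a ≠ d ∧ b ≠ c ∧ b ≠ d) := by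
  by_cases hne : ({a, b} : Finset ℕ) = {c, d}
  · have h1 : a ∈ ({c, d} : Finset ℕ) := by rw [← hne]; simp
    have h2 : b ∈ ({c, d} : Finset ℕ) := by rw [← hne]; simp
    have h3 := hab.1
    have h4 := hcd.1
    simp only [Finset.mem_insert, Finset.mem_singleton] at h1 h2
    omega
  · have := h.2.2 _ hab.2 _ hcd.2 hne
    simp only [Finset.disjoint_left, Finset.mem_insert, Finset.mem_singleton] at this
    have h1 := this (a := a)
    have h2 := this (a := b)
    right
    simp only [true_or, or_true, forall_const, not_or] at h1 h2
    tauto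

theorem NonCrossing.not_cross (hnc : NonCrossing π) {a b c d : ℕ} (hac : IsArc π a c)
    (hbd : IsArc π b d) : ¬(a < b ∧ b < c ∧ c < d) := by
  rintro ⟨h1, h2, h3⟩
  refine hnc _ hac.2 _ hbd.2 ?_ ⟨a, by simp, b, by simp, c, by simp, d, by simp, h1, h2, h3⟩
  intro he
  have : a ∈ ({b, d} : Finset ℕ) := by rw [← he]; simp
  simp only [Finset.mem_insert, Finset.mem_singleton] at this
  omega

/-- The points strictly inside an arc are matched among themselves. -/
theorem IsArc.even_card_Ioo (h : IsPairPartition m π) (hnc : NonCrossing π) {a b : ℕ}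
    (hab : IsArc π a b) : Even (b - a - 1) := by
  have hU : Finset.Ioo a b = (π.filter (· ⊆ Finset.Ioo a b)).biUnion id := by
    ext i
    simp only [Finset.mem_biUnion, Finset.mem_filter, id]
    constructor
    · intro hi
      have hm := h.isArc_mem hab
      simp only [Finset.mem_Icc, Finset.mem_Ioo] at hm hi
      have key : ∀ c d, IsArc π c d → (i = c ∨ i = d) →
          ∃ P, (P ∈ π ∧ P ⊆ Finset.Ioo a b) ∧ i ∈ P := by
        intro c d hcd hic
        refine ⟨{c, d}, ⟨hcd.2, ?_⟩, by simpa using hic⟩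
        have h1 := h.arc_endpoints hab hcd
        have h2 := hcd.1
        have h3 := hnc.not_cross hab hcd
        have h4 := hnc.not_cross hcd hab
        intro x hx
        simp only [Finset.mem_insert, Finset.mem_singleton, Finset.mem_Ioo] at hx ⊢
        omega
      rcases h.exists_partner (i := i) (by simp; omega) with ⟨j, hj⟩ | ⟨j, hj⟩
      · exact key _ _ hj (Or.inl rfl)
      · exact key _ _ hj (Or.inr rfl)
    · rintro ⟨P, ⟨-, hP⟩, hi⟩
      exact hP hi
  have hc : (Finset.Ioo a b).card = (π.filter (· ⊆ Finset.Ioo a b)).card * 2 := by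
    conv_lhs => rw [hU]
    rw [Finset.card_biUnion]
    · exact Finset.sum_const_nat fun P hP => h.1 P (Finset.mem_filter.1 hP).1
    · intro P hP Q hQ hne
      exact h.2.2 P (Finset.mem_filter.1 hP).1 Q (Finset.mem_filter.1 hQ).1 hne
  rw [Nat.card_Ioo] at hc
  rw [hc]
  exact even_two.mul_left _

end Arcs

open Classical in
/-- The points of `{1, …, m}` that are odd and in a blue pair, or even and not in a blue pair. -/
noncomputable def encode (m : ℕ) (c : Finset (Finset ℕ) × Finset (Finset ℕ)) : Finset ℕ :=
  (Finset.Icc 1 m).filter fun i => (∃ P ∈ c.1, i ∈ P) ↔ Odd i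

theorem mem_encode {m i : ℕ} {c : Finset (Finset ℕ) × Finset (Finset ℕ)} :
    i ∈ encode m c ↔ i ∈ Finset.Icc 1 m ∧ ((∃ P ∈ c.1, i ∈ P) ↔ Odd i) := by
  classical
  simp [encode]

theorem encode_mem_powersetCard {n : ℕ} {c : Finset (Finset ℕ) × Finset (Finset ℕ)}
    (h : IsPairPartition (2 * n) (c.1 ∪ c.2)) (hnc : NonCrossing (c.1 ∪ c.2)) :
    encode (2 * n) c ∈ Finset.powersetCard n (Finset.Icc 1 (2 * n)) := by
  classical
  rw [Finset.mem_powersetCard]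
  refine ⟨fun i hi => (mem_encode.1 hi).1, ?_⟩
  have hdisj : ((c.1 ∪ c.2 : Finset (Finset ℕ)) : Set (Finset ℕ)).PairwiseDisjoint id :=
    fun P hP Q hQ hne => h.2.2 P hP Q hQ hne
  have hU : Finset.Icc 1 (2 * n) = (c.1 ∪ c.2).biUnion id := by
    ext i
    rw [← h.2.1 i]
    simp only [Finset.mem_biUnion, id]
  have hcard : 2 * n = (c.1 ∪ c.2).card * 2 := by
    have := congrArg Finset.card hU
    rw [Nat.card_Icc, Finset.card_biUnion hdisj,
      Finset.sum_const_nat (m := 2) (f := fun P : Finset ℕ => (id P).card) h.1] at this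
    omega
  have hA : encode (2 * n) c = (c.1 ∪ c.2).biUnion fun P => P ∩ encode (2 * n) c := by
    ext i
    simp only [Finset.mem_biUnion, Finset.mem_inter]
    constructor
    · intro hi
      obtain ⟨P, hP, hiP⟩ := (h.2.1 i).2 (mem_encode.1 hi).1
      exact ⟨P, hP, hiP, hi⟩
    · rintro ⟨P, -, -, hi⟩
      exact hi
  rw [hA, Finset.card_biUnion, Finset.sum_const_nat (m := 1)]
  · omega
  · intro P hP
    obtain ⟨a, b, hab, rfl⟩ := h.exists_isArc hP
    have hev := hab.even_card_Ioo h hnc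
    have hlt := hab.1
    have hpar : Odd a ↔ ¬ Odd b := by
      rw [Nat.odd_iff, Nat.odd_iff]
      rw [Nat.even_iff] at hev
      omega
    have hm := h.isArc_mem hab
    have hcol : (∃ P ∈ c.1, a ∈ P) ↔ ∃ P ∈ c.1, b ∈ P := by
      constructor
      · rintro ⟨Q, hQ, hi⟩
        refine ⟨Q, hQ, ?_⟩
        rw [h.eq_of_mem (Finset.mem_union_left _ hQ) hP hi (by simp)]
        simp
      · rintro ⟨Q, hQ, hi⟩
        refine ⟨Q, hQ, ?_⟩
        rw [h.eq_of_mem (Finset.mem_union_left _ hQ) hP hi (by simp)]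
        simp
    have ha : a ∈ encode (2 * n) c ↔ b ∉ encode (2 * n) c := by
      rw [mem_encode, mem_encode, hcol, hpar]
      simp only [hm.1, hm.2, true_and]
      by_cases ho : Odd b <;>
        simp only [ho, iff_true, iff_false, not_true_eq_false, not_false_eq_true, not_not]
    rw [Finset.card_eq_one]
    by_cases hb : b ∈ encode (2 * n) c
    · refine ⟨b, ?_⟩
      ext i
      simp only [Finset.mem_inter, Finset.mem_insert, Finset.mem_singleton]
      constructor
      · rintro ⟨rfl | rfl, hi⟩
        · exact absurd hb (ha.1 hi)
        · rfl
      · rintro rfl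
        exact ⟨Or.inr rfl, hb⟩
    · refine ⟨a, ?_⟩
      ext i
      simp only [Finset.mem_inter, Finset.mem_insert, Finset.mem_singleton]
      constructor
      · rintro ⟨rfl | rfl, hi⟩
        · rfl
        · exact absurd hi hb
      · rintro rfl
        exact ⟨Or.inl rfl, ha.2 hb⟩
  · intro P hP Q hQ hne
    exact (h.2.2 P hP Q hQ hne).mono Finset.inter_subset_left Finset.inter_subset_left

theorem MemTCNC2.isArc_of_forall_lt {n : ℕ} {c c' : Finset (Finset ℕ) × Finset (Finset ℕ)}
    (hc : MemTCNC2 2 2 n c) (hc' : MemTCNC2 2 2 n c')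
    (hcol : ∀ i, (∃ P ∈ c.1, i ∈ P) ↔ ∃ P ∈ c'.1, i ∈ P) {a b : ℕ}
    (ih : ∀ q < b, ∀ p, IsArc (c.1 ∪ c.2) p q ↔ IsArc (c'.1 ∪ c'.2) p q)
    (hab : IsArc (c.1 ∪ c.2) a b) : IsArc (c'.1 ∪ c'.2) a b := by
  obtain ⟨hd, hp, hnc, hb1, hb2⟩ := hc
  obtain ⟨hd', hp', hnc', hb1', hb2'⟩ := hc'
  have hm := hp.isArc_mem hab
  have hlt := hab.1
  have hopen : ∃ z, IsArc (c'.1 ∪ c'.2) a z ∧ b ≤ z := by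
    rcases hp'.exists_partner hm.1 with ⟨z, hz⟩ | ⟨z, hz⟩
    · refine ⟨z, hz, ?_⟩
      by_contra hzb
      have := hp.arc_endpoints hab ((ih z (by omega) a).2 hz)
      omega
    · have h1 := (ih a hlt z).2 hz
      have := hp.arc_endpoints hab h1
      have := h1.1
      omega
  obtain ⟨z, hz, hbz⟩ := hopen
  rcases hbz.eq_or_lt with rfl | hbz
  · exact hz
  exfalso
  rcases hp'.exists_partner hm.2 with ⟨y, hy⟩ | ⟨x, hx⟩
  · have hby := hy.1
    have hyz : y < z := by
      have h1 := hp'.arc_endpoints hz hy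
      have h2 := hnc'.not_cross hz hy
      omega
    have hnest : Nested {b, y} {a, z} := (nested_pair_iff hy.1 hz.1).2 ⟨hlt, hyz⟩
    have hR : ∀ R ∈ c'.1 ∪ c'.2, R ≠ {a, z} → Nested {b, y} R → Nested {a, z} R := by
      intro R hRm hne hn
      obtain ⟨p, q, hpq, rfl⟩ := hp'.exists_isArc hRm
      rw [nested_pair_iff hy.1 hpq.1] at hn
      rw [nested_pair_iff hz.1 hpq.1]
      have h1 := hp'.arc_endpoints hz hpq
      rcases h1 with ⟨rfl, rfl⟩ | h1
      · exact absurd rfl hne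
      rcases lt_or_ge p a with hpa | hpa
      · have := hnc'.not_cross hpq hz
        omega
      · exfalso
        have hpm := (hp'.isArc_mem hpq).1
        rcases hp.exists_partner hpm with ⟨w, hw⟩ | ⟨w, hw⟩
        · have h2 := hp.arc_endpoints hab hw
          have h3 := hnc.not_cross hab hw
          have h4 := hw.1
          have h5 := hp'.arc_endpoints hpq ((ih w (by omega) p).1 hw)
          omega
        · have h2 := (ih p hn.1 w).1 hw
          have h3 := hp'.arc_endpoints hpq h2
          have := hpq.1
          omega
    have hne : ({a, z} : Finset ℕ) ≠ {b, y} := by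
      intro he
      have : a ∈ ({b, y} : Finset ℕ) := by rw [← he]; simp
      simp only [Finset.mem_insert, Finset.mem_singleton] at this
      omega
    by_cases hblue : {a, b} ∈ c.1
    · have h1 : ∀ i j, IsArc (c'.1 ∪ c'.2) i j → i ∈ ({a, b} : Finset ℕ) → {i, j} ∈ c'.1 := by
        intro i j hij hi
        obtain ⟨P, hP, hiP⟩ := (hcol i).1 ⟨_, hblue, hi⟩
        rwa [hp'.eq_of_mem hij.2 (Finset.mem_union_left _ hP) (by simp) hiP]
      have haz := h1 a z hz (by simp)
      have hbe := h1 b y hy (by simp)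
      refine hne ((relDepth_le_one_iff hbe).1 (hb1' _ hbe) _ haz hnest fun R hRm hn => ?_)
      refine hR R (Finset.mem_union_right _ hRm) ?_ hn
      rintro rfl
      exact Finset.disjoint_left.1 hd' haz hRm
    · have h1 : ∀ i j, IsArc (c'.1 ∪ c'.2) i j → i ∈ ({a, b} : Finset ℕ) → {i, j} ∈ c'.2 := by
        intro i j hij hi
        refine (Finset.mem_union.1 hij.2).resolve_left fun hcon => hblue ?_
        obtain ⟨P, hP, hiP⟩ := (hcol i).2 ⟨_, hcon, by simp⟩
        rwa [hp.eq_of_mem hab.2 (Finset.mem_union_left _ hP) hi hiP]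
      have haz := h1 a z hz (by simp)
      have hbe := h1 b y hy (by simp)
      refine hne ((relDepth_le_one_iff hbe).1 (hb2' _ hbe) _ haz hnest fun R hRm hn => ?_)
      refine hR R (Finset.mem_union_left _ hRm) ?_ hn
      rintro rfl
      exact Finset.disjoint_left.1 hd' hRm haz
  · have hxm := (hp'.isArc_mem hx).1
    have hxb := hx.1
    have h1 := hp'.arc_endpoints hz hx
    have h2 := hnc'.not_cross hx hz
    rcases hp.exists_partner hxm with ⟨w, hw⟩ | ⟨w, hw⟩
    · have h3 := hp.arc_endpoints hab hw
      have h4 := hnc.not_cross hab hw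
      have h5 := hw.1
      have h6 := hp'.arc_endpoints hx ((ih w (by omega) x).1 hw)
      omega
    · have h3 := (ih x hxb w).1 hw
      have h4 := hp'.arc_endpoints hx h3
      omega

theorem encode_injOn (n : ℕ) : Set.InjOn (encode (2 * n)) {c | MemTCNC2 2 2 n c} := by
  intro c hc c' hc' he
  rw [Set.mem_ofPred_eq] at hc hc'
  have hp := hc.2.1
  have hp' := hc'.2.1
  have hcol : ∀ i, (∃ P ∈ c.1, i ∈ P) ↔ ∃ P ∈ c'.1, i ∈ P := by
    intro i
    by_cases hi : i ∈ Finset.Icc 1 (2 * n)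
    · have := congrArg (i ∈ ·) he
      simp only [mem_encode, hi, true_and, eq_iff_iff] at this
      by_cases ho : Odd i <;> simpa only [ho, iff_true, iff_false, not_iff_not] using this
    · constructor
      · rintro ⟨P, hP, hiP⟩
        exact absurd ((hp.2.1 i).1 ⟨P, Finset.mem_union_left _ hP, hiP⟩) hi
      · rintro ⟨P, hP, hiP⟩
        exact absurd ((hp'.2.1 i).1 ⟨P, Finset.mem_union_left _ hP, hiP⟩) hi
  have harc : ∀ q p, IsArc (c.1 ∪ c.2) p q ↔ IsArc (c'.1 ∪ c'.2) p q := by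
    intro q
    induction q using Nat.strong_induction_on with
    | _ q ih =>
      intro p
      exact ⟨hc.isArc_of_forall_lt hc' hcol ih,
        hc'.isArc_of_forall_lt hc (fun i => (hcol i).symm) fun q hq p => (ih q hq p).symm⟩
  have hpi : c.1 ∪ c.2 = c'.1 ∪ c'.2 := by
    ext P
    constructor
    · intro hP
      obtain ⟨a, b, hab, rfl⟩ := hp.exists_isArc hP
      exact ((harc b a).1 hab).2
    · intro hP
      obtain ⟨a, b, hab, rfl⟩ := hp'.exists_isArc hP
      exact ((harc b a).2 hab).2
  have hsub : ∀ P ∈ c.1 ∪ c.2, P ∈ c.1 ↔ P ∈ c'.1 := by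
    intro P hP
    obtain ⟨a, b, -, rfl⟩ := hp.exists_isArc hP
    constructor
    · intro h
      obtain ⟨Q, hQ, hi⟩ := (hcol a).1 ⟨_, h, by simp⟩
      rw [hpi] at hP
      rwa [hp'.eq_of_mem hP (Finset.mem_union_left _ hQ) (by simp) hi]
    · intro h
      obtain ⟨Q, hQ, hi⟩ := (hcol a).2 ⟨_, h, by simp⟩
      rwa [hp.eq_of_mem hP (Finset.mem_union_left _ hQ) (by simp) hi]
  have h1 : c.1 = c'.1 := by
    ext P
    exact ⟨fun h => (hsub P (Finset.mem_union_left _ h)).1 h,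
      fun h => (hsub P (hpi ▸ Finset.mem_union_left _ h)).2 h⟩
  refine Prod.ext h1 ?_
  rw [← Finset.union_sdiff_cancel_left hc.1, ← Finset.union_sdiff_cancel_left hc'.1, hpi, h1]

/-- A walk on `ℤ` with steps `±1` from `0` to `0` in `m` steps. -/
structure IsBridge (m : ℕ) (h : ℕ → ℤ) : Prop where
  zero : h 0 = 0
  step : ∀ j, h (j + 1) = h j + 1 ∨ h (j + 1) = h j - 1
  last : h m = 0

/-- The step of `h` starting at time `p` leads away from the origin, and the step ending at time
`q` is the first one to come back. -/
def IsMatch (m : ℕ) (h : ℕ → ℤ) (p q : ℕ) : Prop :=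
  p < q ∧ q ≤ m ∧ (h p).natAbs = (h q).natAbs ∧ ∀ j, p < j → j < q → (h p).natAbs < (h j).natAbs

namespace IsBridge

variable {m : ℕ} {h : ℕ → ℤ}

theorem emod_two (hb : IsBridge m h) (j : ℕ) : h j % 2 = (j : ℤ) % 2 := by
  induction j with
  | zero => simp [hb.zero]
  | succ j ih =>
    have := hb.step j
    push_cast
    omega

theorem exists_match_of_lt (hb : IsBridge m h) {p : ℕ} (hp : p < m)
    (hup : (h p).natAbs < (h (p + 1)).natAbs) : ∃ q, IsMatch m h p q := by
  classical
  have hex : ∃ q, p < q ∧ (h q).natAbs ≤ (h p).natAbs := ⟨m, hp, by simp [hb.last]⟩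
  obtain ⟨h1, h2⟩ := Nat.find_spec hex
  have hmin : ∀ j, p < j → j < Nat.find hex → (h p).natAbs < (h j).natAbs := by
    intro j hj hjq
    have := Nat.find_min hex hjq
    omega
  have hle : Nat.find hex ≤ m := Nat.find_min' hex ⟨hp, by simp [hb.last]⟩
  generalize Nat.find hex = q at *
  obtain ⟨k, rfl⟩ : ∃ k, q = k + 1 := ⟨q - 1, by omega⟩
  refine ⟨k + 1, h1, hle, ?_, hmin⟩
  have hs := hb.step k
  rcases Nat.lt_or_ge p k with hpk | hpk
  · have := hmin k hpk (by omega)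
    omega
  · obtain rfl : k = p := by omega
    omega

theorem exists_match_of_gt (hb : IsBridge m h) {q : ℕ} (hq : q + 1 ≤ m)
    (hdown : (h (q + 1)).natAbs < (h q).natAbs) : ∃ p, IsMatch m h p (q + 1) := by
  classical
  have h0 : (h 0).natAbs ≤ (h (q + 1)).natAbs := by simp [hb.zero]
  have h1 := Nat.findGreatest_spec (P := fun p => (h p).natAbs ≤ (h (q + 1)).natAbs)
    (Nat.zero_le q) h0
  have h2 : ∀ j, Nat.findGreatest (fun p => (h p).natAbs ≤ (h (q + 1)).natAbs) q < j → j ≤ q →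
      (h (q + 1)).natAbs < (h j).natAbs := by
    intro j hj hjq
    have := Nat.findGreatest_is_greatest hj hjq
    omega
  have h3 := Nat.findGreatest_le (P := fun p => (h p).natAbs ≤ (h (q + 1)).natAbs) q
  generalize Nat.findGreatest (fun p => (h p).natAbs ≤ (h (q + 1)).natAbs) q = p at *
  have hs := hb.step p
  have heq : (h p).natAbs = (h (q + 1)).natAbs := by
    rcases h3.eq_or_lt with rfl | hlt
    · omega
    · have := h2 (p + 1) (by omega) (by omega)
      omega
  exact ⟨p, by omega, hq, heq, fun j hj hjq => by rw [heq]; exact h2 j hj (by omega)⟩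

theorem exists_match (hb : IsBridge m h) {i : ℕ} (hi : i ∈ Finset.Icc 1 m) :
    ∃ p q, IsMatch m h p q ∧ (i = p + 1 ∨ i = q) := by
  rw [Finset.mem_Icc] at hi
  obtain ⟨j, rfl⟩ : ∃ j, i = j + 1 := ⟨i - 1, by omega⟩
  have hs := hb.step j
  rcases lt_or_ge (h j).natAbs (h (j + 1)).natAbs with hlt | hge
  · obtain ⟨q, hq⟩ := hb.exists_match_of_lt (by omega) hlt
    exact ⟨j, q, hq, Or.inl rfl⟩
  · obtain ⟨p, hp⟩ := hb.exists_match_of_gt hi.2 (by omega)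
    exact ⟨p, j + 1, hp, Or.inr rfl⟩

end IsBridge

namespace IsMatch

variable {m : ℕ} {h : ℕ → ℤ} {p q p' q' : ℕ}

theorem succ_lt (hb : IsBridge m h) (hm : IsMatch m h p q) : p + 1 < q := by
  obtain ⟨h1, -, h2, -⟩ := hm
  by_contra hcon
  obtain rfl : q = p + 1 := by omega
  have := hb.step p
  omega

theorem pos_iff (hb : IsBridge m h) (hm : IsMatch m h p q) {j : ℕ} (hpj : p < j) (hjq : j < q) :
    0 < h j ↔ 0 < h (p + 1) := by
  induction j, hpj using Nat.le_induction with
  | base => rfl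
  | succ j hj ih =>
    rw [← ih (by omega)]
    have h1 := hm.2.2.2 j hj (by omega)
    have h2 := hm.2.2.2 (j + 1) (by omega) hjq
    have := hb.step j
    omega

theorem steps (hb : IsBridge m h) (hm : IsMatch m h p q) :
    h q = h p ∧ h (q - 1) = h (p + 1) := by
  have hlt := hm.succ_lt hb
  obtain ⟨k, rfl⟩ : ∃ k, q = k + 1 := ⟨q - 1, by omega⟩
  rw [Nat.add_sub_cancel]
  have h1 := hm.pos_iff hb (j := k) (by omega) (by omega)
  have h2 := hm.2.2.2 k (by omega) (by omega)
  have h3 := hm.2.2.2 (p + 1) (by omega) hlt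
  have h4 := hm.2.2.1
  have h5 := hb.step p
  have h6 := hb.step k
  omega

theorem endpoints (hb : IsBridge m h) (hm : IsMatch m h p q) (hm' : IsMatch m h p' q') :
    (p = p' ∧ q = q') ∨ (p ≠ p' ∧ p + 1 ≠ q' ∧ p' + 1 ≠ q ∧ q ≠ q') := by
  have key : ∀ {p q p' q'}, IsMatch m h p q → IsMatch m h p' q' → p + 1 ≠ q' := by
    rintro p q p' q' hm hm' rfl
    have h1 := hm.2.2.2 (p + 1) (by omega) (hm.succ_lt hb)
    have h2 := hm'.2.2.2 p (by have := hm'.succ_lt hb; omega) (by omega)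
    have h3 := hm'.2.2.1
    omega
  have h1 := key hm hm'
  have h2 := key hm' hm
  have h3 : p = p' → q = q' := by
    rintro rfl
    have h4 := hm.2.2.2 q' hm'.1
    have h5 := hm'.2.2.2 q hm.1
    have h6 := hm.2.2.1
    have h7 := hm'.2.2.1
    omega
  have h4 : q = q' → p = p' := by
    rintro rfl
    have h4 := hm.2.2.2 p'
    have h5 := hm'.2.2.2 p
    have h6 := hm.2.2.1
    have h7 := hm'.2.2.1
    have h8 := hm.1
    have h9 := hm'.1
    omega
  omega

theorem pair_eq_iff (hb : IsBridge m h) (hm : IsMatch m h p q) (hm' : IsMatch m h p' q') :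
    ({p + 1, q} : Finset ℕ) = {p' + 1, q'} ↔ p = p' ∧ q = q' := by
  constructor
  · intro he
    have h1 : p + 1 ∈ ({p' + 1, q'} : Finset ℕ) := by rw [← he]; simp
    have := hm.endpoints hb hm'
    simp only [Finset.mem_insert, Finset.mem_singleton] at h1
    omega
  · rintro ⟨rfl, rfl⟩
    rfl

theorem not_cross (hm : IsMatch m h p q) (hm' : IsMatch m h p' q') :
    ¬(p < p' ∧ p' < q ∧ q < q') := by
  rintro ⟨h1, h2, h3⟩
  have h4 := hm.2.2.2 p' h1 h2
  have h5 := hm'.2.2.2 q h2 h3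
  have h6 := hm.2.2.1
  omega

/-- If the arc of `p` is nested in the arc of `p'`, then the arc immediately around that of `p`
traverses an edge of `ℤ` adjacent to the one traversed by `p`. -/
theorem exists_parent (hb : IsBridge m h) (hm : IsMatch m h p q) (hm' : IsMatch m h p' q')
    (hp : p' < p) (hq : q < q') :
    ∃ r s, IsMatch m h r s ∧ p' ≤ r ∧ r < p ∧ q < s ∧
      ((h (r + 1) = h r + 1 ↔ Even r) ↔ ¬(h (p + 1) = h p + 1 ↔ Even p)) := by
  classical
  have hpq := hm.succ_lt hb
  have h0 : (h p').natAbs < (h p).natAbs := hm'.2.2.2 p hp (by omega)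
  have h1 := Nat.findGreatest_spec (P := fun r => (h r).natAbs < (h p).natAbs)
    (show p' ≤ p by omega) h0
  have h2 : ∀ j, Nat.findGreatest (fun r => (h r).natAbs < (h p).natAbs) p < j → j ≤ p →
      (h p).natAbs ≤ (h j).natAbs := by
    intro j hj hjq
    have := Nat.findGreatest_is_greatest hj hjq
    omega
  have h3 := Nat.findGreatest_le (P := fun r => (h r).natAbs < (h p).natAbs) p
  have h4 := Nat.le_findGreatest (P := fun r => (h r).natAbs < (h p).natAbs)
    (show p' ≤ p by omega) h0
  generalize Nat.findGreatest (fun r => (h r).natAbs < (h p).natAbs) p = r at *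
  have hrp : r < p := by
    refine lt_of_le_of_ne h3 ?_
    rintro rfl
    omega
  have hsr := hb.step r
  have hr1 := h2 (r + 1) (by omega) (by omega)
  have hqm := hm.2.1
  obtain ⟨s, hs⟩ := hb.exists_match_of_lt (p := r) (by omega) (by omega)
  have hqs : q < s := by
    by_contra hcon
    have e1 := hs.1
    have e2 := hs.2.2.1
    have e3 := hm.2.2.1
    have e4 := hm.2.2.2 s
    have e5 := h2 s e1
    rcases lt_trichotomy s q with hlt | rfl | hgt
    · omega
    · omega
    · omega
  refine ⟨r, s, hs, h4, hrp, hqs, ?_⟩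
  have f1 := hs.pos_iff hb (j := p) hrp (by omega)
  have f2 := hs.pos_iff hb (j := p + 1) (by omega) (by omega)
  have f3 := hm.2.2.2 (p + 1) (by omega) hpq
  have f4 := hb.step p
  have f5 : h p = h (r + 1) := by omega
  have f6 : h (r + 1) = h r + 1 ↔ h (p + 1) = h p + 1 := by omega
  have f7 : Even r ↔ ¬Even p := by
    have g1 := hb.emod_two p
    have g2 := hb.emod_two (r + 1)
    rw [Nat.even_iff, Nat.even_iff]
    push_cast at g2
    omega
  rw [f6, f7]
  by_cases ho : Even p <;>
    simp only [ho, iff_true, iff_false, not_true_eq_false, not_false_eq_true, not_not]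

theorem up_iff (hb : IsBridge m h) (hm : IsMatch m h p q) {i : ℕ} (hi : i = p + 1 ∨ i = q) :
    ((h (p + 1) = h p + 1 ↔ Even p) ↔ Odd i) ↔ h i = h (i - 1) + 1 := by
  rcases hi with rfl | rfl
  · rw [Nat.add_sub_cancel, Nat.odd_add_one, Nat.not_odd_iff_even]
    by_cases ho : Even p <;> simp [ho]
  · obtain ⟨h1, h2⟩ := hm.steps hb
    have h3 : Odd i ↔ ¬Even p := by
      have g1 := hb.emod_two p
      have g2 := hb.emod_two i
      rw [Nat.odd_iff, Nat.even_iff]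
      omega
    have h4 := hb.step p
    rw [h1, h2, h3]
    by_cases ho : Even p <;> simp only [ho, iff_true, iff_false, not_true_eq_false,
      not_false_eq_true] <;> omega

end IsMatch

open Classical in
/-- The pairs of times of matching steps of `h` whose first step starts at a time satisfying `C`. -/
noncomputable def matchPairs (m : ℕ) (h : ℕ → ℤ) (C : ℕ → Prop) : Finset (Finset ℕ) :=
  ((Finset.range (m + 1) ×ˢ Finset.range (m + 1)).filter
    fun x => IsMatch m h x.1 x.2 ∧ C x.1).image fun x => {x.1 + 1, x.2}

theorem mem_matchPairs {m : ℕ} {h : ℕ → ℤ} {C : ℕ → Prop} {P : Finset ℕ} :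
    P ∈ matchPairs m h C ↔ ∃ p q, IsMatch m h p q ∧ C p ∧ P = {p + 1, q} := by
  classical
  simp only [matchPairs, Finset.mem_image, Finset.mem_filter, Finset.mem_product,
    Finset.mem_range, Prod.exists]
  constructor
  · rintro ⟨p, q, ⟨-, h1, h2⟩, rfl⟩
    exact ⟨p, q, h1, h2, rfl⟩
  · rintro ⟨p, q, h1, h2, rfl⟩
    have h3 := h1.1
    have h4 := h1.2.1
    exact ⟨p, q, ⟨⟨by omega, by omega⟩, h1, h2⟩, rfl⟩

theorem mem_matchPairs_union {m : ℕ} {h : ℕ → ℤ} {C : ℕ → Prop} {P : Finset ℕ} :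
    P ∈ matchPairs m h C ∪ matchPairs m h (fun p => ¬C p) ↔
      ∃ p q, IsMatch m h p q ∧ P = {p + 1, q} := by
  rw [Finset.mem_union, mem_matchPairs, mem_matchPairs]
  constructor
  · rintro (⟨p, q, h1, -, h2⟩ | ⟨p, q, h1, -, h2⟩) <;> exact ⟨p, q, h1, h2⟩
  · rintro ⟨p, q, h1, h2⟩
    by_cases hC : C p
    · exact Or.inl ⟨p, q, h1, hC, h2⟩
    · exact Or.inr ⟨p, q, h1, hC, h2⟩

theorem relDepth_matchPairs_le_one {m : ℕ} {h : ℕ → ℤ} (hb : IsBridge m h) {C D : ℕ → Prop}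
    (hCD : ∀ r p, ((h (r + 1) = h r + 1 ↔ Even r) ↔ ¬(h (p + 1) = h p + 1 ↔ Even p)) →
      C p → D r) {P : Finset ℕ} (hP : P ∈ matchPairs m h C) :
    relDepth (matchPairs m h C) (matchPairs m h D) P ≤ 1 := by
  rw [relDepth_le_one_iff hP]
  obtain ⟨p, q, hm, hC, rfl⟩ := mem_matchPairs.1 hP
  intro Q hQ hPQ hR
  obtain ⟨p', q', hm', -, rfl⟩ := mem_matchPairs.1 hQ
  rw [nested_pair_iff (hm.succ_lt hb) (hm'.succ_lt hb)] at hPQ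
  obtain ⟨r, s, hrs, hpr, hrp, hqs, hcol⟩ := hm.exists_parent hb hm' (by omega) hPQ.2
  have h1 := hR _ (mem_matchPairs.2 ⟨r, s, hrs, hCD r p hcol hC, rfl⟩)
    ((nested_pair_iff (hm.succ_lt hb) (hrs.succ_lt hb)).2 ⟨by omega, hqs⟩)
  rw [nested_pair_iff (hm'.succ_lt hb) (hrs.succ_lt hb)] at h1
  omega

/-- The two-colored pair partition of the matching steps of a walk, where a pair is blue if its
steps traverse an edge `{k, k + 1}` of `ℤ` with `k` even. -/
noncomputable def bridgePartition (m : ℕ) (h : ℕ → ℤ) :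
    Finset (Finset ℕ) × Finset (Finset ℕ) :=
  (matchPairs m h fun p => h (p + 1) = h p + 1 ↔ Even p,
    matchPairs m h fun p => ¬(h (p + 1) = h p + 1 ↔ Even p))

theorem memTCNC2_bridgePartition {n : ℕ} {h : ℕ → ℤ} (hb : IsBridge (2 * n) h) :
    MemTCNC2 2 2 n (bridgePartition (2 * n) h) := by
  refine ⟨?_, ⟨?_, ?_, ?_⟩, ?_, ?_, ?_⟩
  · rw [Finset.disjoint_left]
    intro P hP hP'
    obtain ⟨p, q, hm, hC, rfl⟩ := mem_matchPairs.1 hP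
    obtain ⟨p', q', hm', hC', he⟩ := mem_matchPairs.1 hP'
    obtain ⟨rfl, rfl⟩ := (hm.pair_eq_iff hb hm').1 he
    exact hC' hC
  · intro P hP
    obtain ⟨p, q, hm, rfl⟩ := mem_matchPairs_union.1 hP
    exact Finset.card_pair (hm.succ_lt hb).ne
  · intro i
    constructor
    · rintro ⟨P, hP, hi⟩
      obtain ⟨p, q, hm, rfl⟩ := mem_matchPairs_union.1 hP
      have h1 := hm.1
      have h2 := hm.2.1
      simp only [Finset.mem_insert, Finset.mem_singleton] at hi
      rw [Finset.mem_Icc]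
      omega
    · intro hi
      obtain ⟨p, q, hm, hpq⟩ := hb.exists_match hi
      exact ⟨_, mem_matchPairs_union.2 ⟨p, q, hm, rfl⟩, by simpa using hpq⟩
  · intro P hP Q hQ hne
    obtain ⟨p, q, hm, rfl⟩ := mem_matchPairs_union.1 hP
    obtain ⟨p', q', hm', rfl⟩ := mem_matchPairs_union.1 hQ
    rw [Ne, hm.pair_eq_iff hb hm'] at hne
    have := hm.endpoints hb hm'
    rw [Finset.disjoint_left]
    intro i h1 h2
    simp only [Finset.mem_insert, Finset.mem_singleton] at h1 h2
    omega
  · rintro P hP Q hQ hne ⟨a, ha, b, hb', c, hc, d, hd, hlt⟩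
    obtain ⟨p, q, hm, rfl⟩ := mem_matchPairs_union.1 hP
    obtain ⟨p', q', hm', rfl⟩ := mem_matchPairs_union.1 hQ
    have h1 := hm.succ_lt hb
    have h2 := hm'.succ_lt hb
    have h3 := hm.not_cross hm'
    simp only [Finset.mem_insert, Finset.mem_singleton] at ha hb' hc hd
    omega
  · intro P hP
    exact relDepth_matchPairs_le_one hb (fun r p h1 h2 h3 => (h1.1 h3) h2) hP
  · intro P hP
    exact relDepth_matchPairs_le_one hb (fun r p h1 h2 => h1.2 h2) hP

theorem mem_encode_bridgePartition {m : ℕ} {h : ℕ → ℤ} (hb : IsBridge m h) {i : ℕ} :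
    i ∈ encode m (bridgePartition m h) ↔ i ∈ Finset.Icc 1 m ∧ h i = h (i - 1) + 1 := by
  rw [mem_encode]
  refine and_congr_right fun hi => ?_
  obtain ⟨p, q, hm, hpq⟩ := hb.exists_match hi
  rw [← hm.up_iff hb hpq]
  refine iff_congr ⟨?_, fun hC => ?_⟩ Iff.rfl
  · rintro ⟨P, hP, hiP⟩
    obtain ⟨p', q', hm', hC, rfl⟩ := mem_matchPairs.1 hP
    have := hm.endpoints hb hm'
    simp only [Finset.mem_insert, Finset.mem_singleton] at hiP
    obtain rfl : p = p' := by omega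
    exact hC
  · exact ⟨_, mem_matchPairs.2 ⟨p, q, hm, hC, rfl⟩, by simpa using hpq⟩

/-- The walk that goes up at the times in `A` and down at all other times. -/
def walk (A : Finset ℕ) (j : ℕ) : ℤ :=
  ∑ i ∈ Finset.Icc 1 j, if i ∈ A then 1 else -1

theorem walk_succ (A : Finset ℕ) (j : ℕ) :
    walk A (j + 1) = walk A j + if j + 1 ∈ A then 1 else -1 :=
  Finset.sum_Icc_succ_top (by omega) _

theorem isBridge_walk {n : ℕ} {A : Finset ℕ}
    (hA : A ∈ Finset.powersetCard n (Finset.Icc 1 (2 * n))) : IsBridge (2 * n) (walk A) := by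
  rw [Finset.mem_powersetCard] at hA
  refine ⟨by simp [walk], fun j => ?_, ?_⟩
  · rw [walk_succ]
    split_ifs
    · exact Or.inl rfl
    · exact Or.inr rfl
  · have h1 : ∀ i, (if i ∈ A then 1 else -1 : ℤ) = 2 * (if i ∈ A then 1 else 0) - 1 := by
      intro i
      split_ifs <;> norm_num
    rw [walk, Finset.sum_congr rfl fun i _ => h1 i, Finset.sum_sub_distrib, ← Finset.mul_sum,
      Finset.sum_ite_mem, Finset.inter_eq_right.2 hA.1]
    simp [hA.2]

theorem encode_bridgePartition_walk {n : ℕ} {A : Finset ℕ}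
    (hA : A ∈ Finset.powersetCard n (Finset.Icc 1 (2 * n))) :
    encode (2 * n) (bridgePartition (2 * n) (walk A)) = A := by
  ext i
  rw [mem_encode_bridgePartition (isBridge_walk hA)]
  have hsub := (Finset.mem_powersetCard.1 hA).1
  have key : i ∈ Finset.Icc 1 (2 * n) → (walk A i = walk A (i - 1) + 1 ↔ i ∈ A) := by
    intro hi
    rw [Finset.mem_Icc] at hi
    obtain ⟨j, rfl⟩ : ∃ j, i = j + 1 := ⟨i - 1, by omega⟩
    rw [walk_succ, Nat.add_sub_cancel]
    split_ifs with hj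
    · simp [hj]
    · simp only [hj, iff_false]
      omega
  exact ⟨fun hi => (key hi.1).1 hi.2, fun hi => ⟨hsub hi, (key (hsub hi)).2 hi⟩⟩

theorem encode_bijOn (n : ℕ) :
    Set.BijOn (encode (2 * n)) {c | MemTCNC2 2 2 n c}
      (Finset.powersetCard n (Finset.Icc 1 (2 * n))) :=
  ⟨fun _ hc => encode_mem_powersetCard hc.2.1 hc.2.2.1, encode_injOn n,
    fun A hA => ⟨bridgePartition (2 * n) (walk A), memTCNC2_bridgePartition (isBridge_walk hA),
      encode_bridgePartition_walk hA⟩⟩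

theorem stmt12 (n : ℕ) (hn : 1 ≤ n) :
    Set.ncard {c : Finset (Finset ℕ) × Finset (Finset ℕ) | MemTCNC2 2 2 n c} =
      Nat.choose (2 * n) n := by
  rw [← (encode_injOn n).ncard_image, (encode_bijOn n).image_eq, Set.ncard_coe_finset,
    Finset.card_powersetCard, Nat.card_Icc, Nat.add_sub_cancel]
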